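/- arXiv:2301.10977 — 4 statements merged into one kernel-verified Lean document; each statement's English description precedes it below -/
import Mathlib

section
/- Let A, B, C, D, ζ, α̃, β̃, u be nonnegative reals and ε a real with ε > D. Define f : (0,∞) × (0,∞) → ℝ by f(e, n) = ((ζ + α̃·e·n + β̃·e + u)/(e·(ε − D)))·(A/n + B·e² + C). Then f is biconvex: for every fixed n > 0 the map e ↦ f(e, n) is convex on (0,∞), and for every fixed e > 0 the map n ↦ f(e, n) is convex on (0,∞). -/
theorem convexOn_add_mul_sq_add_mul_inv {c₂ c₃ : ℝ} (c₀ c₁ : ℝ) (h₂ : 0 ≤ c₂) (h₃ : 0 ≤ c₃) :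
    ConvexOn ℝ (Set.Ioi (0 : ℝ)) (fun x : ℝ => c₀ + c₁ * x + c₂ * x ^ 2 + c₃ * x⁻¹) := by
  have hlin : ConvexOn ℝ (Set.Ioi (0 : ℝ)) (fun x : ℝ => c₀ + c₁ * x) := by
    refine ⟨convex_Ioi 0, fun x _ y _ a b _ _ hab => le_of_eq ?_⟩
    simp only [smul_eq_mul]
    linear_combination -c₀ * hab
  have hsq : ConvexOn ℝ (Set.Ioi (0 : ℝ)) (fun x : ℝ => x ^ 2) := by
    simpa using convexOn_zpow (𝕜 := ℝ) 2
  have hinv : ConvexOn ℝ (Set.Ioi (0 : ℝ)) (fun x : ℝ => x⁻¹) := by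
    simpa using convexOn_zpow (𝕜 := ℝ) (-1)
  exact (hlin.add (hsq.smul h₂)).add (hinv.smul h₃)

/-- Lemma 1 of the paper: the approximate expected model-training time of TS-FL-SC,
`f(e, n) = ((ζ + α̃·e·n + β̃·e + u)/(e·(ε − D)))·(A/n + B·e² + C)`,
is biconvex on `(0,∞) × (0,∞)`: convex in the local epoch number `e` for each fixed
mini-batch size `n > 0`, and convex in `n` for each fixed `e > 0`. -/
theorem stmt_1 (A B C D ζ α β u ε : ℝ)
    (hA : 0 ≤ A) (hB : 0 ≤ B) (hC : 0 ≤ C) (hD : 0 ≤ D)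
    (hζ : 0 ≤ ζ) (hα : 0 ≤ α) (hβ : 0 ≤ β) (hu : 0 ≤ u)
    (hε : D < ε) :
    (∀ n : ℝ, 0 < n →
      ConvexOn ℝ (Set.Ioi (0 : ℝ))
        (fun e : ℝ => (ζ + α * e * n + β * e + u) / (e * (ε - D)) * (A / n + B * e ^ 2 + C))) ∧
    (∀ e : ℝ, 0 < e →
      ConvexOn ℝ (Set.Ioi (0 : ℝ))
        (fun n : ℝ => (ζ + α * e * n + β * e + u) / (e * (ε - D)) * (A / n + B * e ^ 2 + C))) := by
  have hδ : 0 < ε - D := sub_pos.mpr hε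
  constructor
  · intro n hn
    refine (convexOn_add_mul_sq_add_mul_inv
      ((α * n + β) * (A / n + C) / (ε - D)) ((ζ + u) * B / (ε - D))
      (c₂ := (α * n + β) * B / (ε - D)) (c₃ := (ζ + u) * (A / n + C) / (ε - D))
      (by positivity) (by positivity)).congr fun e he => ?_
    have he' : e ≠ 0 := ne_of_gt he
    field_simp
    ring
  · intro e he
    refine (convexOn_add_mul_sq_add_mul_inv
      ((((ζ + u) / e + β) * (B * e ^ 2 + C) + α * A) / (ε - D)) (α * (B * e ^ 2 + C) / (ε - D))
      (c₂ := 0) (c₃ := ((ζ + u) / e + β) * A / (ε - D))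
      le_rfl (by positivity)).congr fun n hn => ?_
    have hn' : n ≠ 0 := ne_of_gt hn
    field_simp
    ring
end

section
/- Work in ℝ^d (or any real inner product space). Consider K servers with weights p_k ≥ 0, Σ_{k=1}^K p_k = 1, local epoch lengths e_k ∈ ℕ₊, H = max_k e_k, and a staleness bound τ ∈ ℕ. Let g_{k,j} (k = 1..K, j ∈ ℕ) be vectors with ‖g_{k,j}‖ ≤ G, and let (η_j) be positive non-increasing learning rates with η_j ≤ 2·η_{j+H+τ} for all j. Define the virtual sequence w̄_t = w_0 − Σ_{k=1}^K p_k Σ_{j=0}^{t−1} η_j g_{k,j}. Each server k produces iterates with w_{k,0} = w_0 and a set I^k ⊆ ℕ of update times such that consecutive elements of I^k ∪ {0} differ by at most e_k; between update times w_{k,t+1} = w_{k,t} − η_t g_{k,t}, and at each update time s ∈ I^k the server receives w_{k,s} = w_0 − Σ_{h=1}^K p_h Σ_{j=0}^{Λ^h_{k,s}−1} η_j g_{h,j}, where the aggregation counters satisfy |Λ^h_{k,s} − s| ≤ τ for every h. Then for every server k and every iteration t: ‖w̄_t − w_{k,t}‖² ≤ 24·η_t²·G²·(2τ² + e_k²).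 -/
/-- Partial sums of a sequence bounded by `C` on `[c, ∞)` with upper
limits at least `c` and at most `n` apart differ by at most `n * C`. -/
lemma norm_sum_range_sub_sum_range_le {E : Type*} [SeminormedAddCommGroup E] {v : ℕ → E} {C : ℝ}
    {a b n c : ℕ} (hC : 0 ≤ C) (hab : a ≤ b + n) (hba : b ≤ a + n) (hca : c ≤ a) (hcb : c ≤ b)
    (hv : ∀ j, c ≤ j → ‖v j‖ ≤ C) :
    ‖∑ j ∈ Finset.range a, v j - ∑ j ∈ Finset.range b, v j‖ ≤ n * C := by
  wlog h : b ≤ a generalizing a b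
  · rw [norm_sub_rev]
    exact this hba hab hcb hca (by omega)
  rw [← Finset.sum_Ico_eq_sub _ h]
  calc ‖∑ j ∈ Finset.Ico b a, v j‖ ≤ (Finset.Ico b a).card • C := by
        refine norm_sum_le_of_le _ (fun j hj => ?_) |>.trans_eq (Finset.sum_const C)
        rw [Finset.mem_Ico] at hj
        exact hv j (by omega)
    _ ≤ n * C := by
        rw [nsmul_eq_mul, Nat.card_Ico]
        gcongr
        omega

/-- A convex combination of vectors of norm at most `C` has norm at most `C`. -/
lemma norm_sum_smul_le_of_sum_eq_one {ι E : Type*} [Fintype ι] [SeminormedAddCommGroup E]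
    [NormedSpace ℝ E] {p : ι → ℝ} (hp : ∀ i, 0 ≤ p i) (hsum : ∑ i, p i = 1) {x : ι → E} {C : ℝ}
    (hx : ∀ i, ‖x i‖ ≤ C) : ‖∑ i, p i • x i‖ ≤ C := by
  calc ‖∑ i, p i • x i‖ ≤ ∑ i, p i * C := by
        refine norm_sum_le_of_le _ fun i _ => ?_
        rw [norm_smul, Real.norm_of_nonneg (hp i)]
        exact mul_le_mul_of_nonneg_left (hx i) (hp i)
    _ = C := by rw [← Finset.sum_mul, hsum, one_mul]

/-- A sequence that moves by `-v t` at step `t`, except when it is reset at a time in `I`, is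
given by its value at the last reset minus the steps taken since. -/
lemma exists_last_reset {E : Type*} [AddCommGroup E] {I : Set ℕ} {x v : ℕ → E}
    (hx : ∀ t, t + 1 ∉ I → x (t + 1) = x t - v t) (t : ℕ) :
    ∃ s ∈ insert 0 I, s ≤ t ∧ (∀ r ∈ I, s < r → t < r) ∧
      x t = x s - (∑ j ∈ Finset.range t, v j - ∑ j ∈ Finset.range s, v j) := by
  induction t with
  | zero => exact ⟨0, Set.mem_insert _ _, le_rfl, fun _ _ h => h, by simp⟩
  | succ t ih =>
    by_cases ht : t + 1 ∈ I
    · exact ⟨t + 1, Set.mem_insert_of_mem _ ht, le_rfl, fun _ _ h => h, by simp⟩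
    · obtain ⟨s, hs, hst, hlast, hxs⟩ := ih
      refine ⟨s, hs, by omega, fun r hr hsr => ?_, ?_⟩
      · have hne : r ≠ t + 1 := fun h => ht (h ▸ hr)
        have := hlast r hr hsr
        omega
      · rw [hx t ht, hxs, Finset.sum_range_succ]
        abel

/-- Lemma 2, first claim (inequality (28)), stated pathwise: in federated learning with
asynchronous coordination — `K` servers with weights `p`, local epoch lengths `e`,
`H = max_k e_k`, staleness bound `τ`, gradients `g k j` bounded in norm by `G`, positive
non-increasing learning rates with `η_j ≤ 2·η_{j+H+τ}`, virtual sequence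
`w̄_t = w₀ − Σ_k p_k Σ_{j<t} η_j g_{k,j}`, local SGD steps between coordination times,
stale global models (with aggregation counters `Λ` within `τ` of the synchronization
index) received at coordination times `I k` whose consecutive gaps are at most `e k` —
every server `k` and iteration `t` satisfy
`‖w̄_t − w_{k,t}‖² ≤ 24·η_t²·G²·(2τ² + e_k²)`. -/
theorem stmt_4 (d K : ℕ)
    (p : Fin K → ℝ) (hp : ∀ k, 0 ≤ p k) (hpsum : ∑ k, p k = 1)
    (e : Fin K → ℕ) (he : ∀ k, 0 < e k)
    (H : ℕ) (hH : H = Finset.univ.sup e)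
    (τ : ℕ)
    (G : ℝ) (hG : 0 ≤ G)
    (g : Fin K → ℕ → EuclideanSpace ℝ (Fin d)) (hg : ∀ k j, ‖g k j‖ ≤ G)
    (η : ℕ → ℝ) (hηpos : ∀ j, 0 < η j) (hηmono : Antitone η)
    (hηdecay : ∀ j, η j ≤ 2 * η (j + H + τ))
    (w0 : EuclideanSpace ℝ (Fin d))
    (wbar : ℕ → EuclideanSpace ℝ (Fin d))
    (hwbar : ∀ t, wbar t = w0 - ∑ k, p k • ∑ j ∈ Finset.range t, η j • g k j)
    (w : Fin K → ℕ → EuclideanSpace ℝ (Fin d))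
    (hw0 : ∀ k, w k 0 = w0)
    (I : Fin K → Set ℕ)
    (hgap : ∀ k, ∀ s ∈ insert 0 (I k), ∃ s' ∈ I k, s < s' ∧ s' ≤ s + e k)
    (Λ : Fin K → Fin K → ℕ → ℕ)
    (hstale : ∀ k h : Fin K, ∀ s ∈ I k, Λ k h s ≤ s + τ ∧ s ≤ Λ k h s + τ)
    (hlocal : ∀ k : Fin K, ∀ t : ℕ, (t + 1) ∉ I k →
      w k (t + 1) = w k t - η t • g k t)
    (hsync : ∀ k : Fin K, ∀ s ∈ I k,
      w k s = w0 - ∑ h, p h • ∑ j ∈ Finset.range (Λ k h s), η j • g h j) :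
    ∀ (k : Fin K) (t : ℕ),
      ‖wbar t - w k t‖ ^ 2 ≤ 24 * η t ^ 2 * G ^ 2 * (2 * (τ : ℝ) ^ 2 + (e k : ℝ) ^ 2) := by
  intro k t
  obtain ⟨s, hs, hst, hlast, hws⟩ := exists_last_reset (hlocal k) t
  obtain ⟨s', hs', hss', hs'e⟩ := hgap k s hs
  have hts : t < s + e k := (hlast s' hs' hss').trans_le hs'e
  have heH : e k ≤ H := hH ▸ Finset.le_sup (Finset.mem_univ k)
  set C : ℝ := 2 * η t * G
  have hC : 0 ≤ C := by have := hηpos t; positivity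
  have hstep : ∀ (h : Fin K) (j : ℕ), s - τ ≤ j → ‖η j • g h j‖ ≤ C := fun h j hj => by
    rw [norm_smul, Real.norm_of_nonneg (hηpos j).le]
    have hηj : η j ≤ 2 * η t :=
      (hηdecay j).trans (mul_le_mul_of_nonneg_left (hηmono (by omega)) zero_le_two)
    exact mul_le_mul hηj (hg h j) (norm_nonneg _) ((hηpos j).le.trans hηj)
  have hdrift : ∀ h : Fin K, ‖∑ j ∈ Finset.range t, η j • g h j -
      ∑ j ∈ Finset.range s, η j • g h j‖ ≤ e k * C := fun h =>
    norm_sum_range_sub_sum_range_le hC (by omega) (by omega) hst le_rfl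
      fun j hj => hstep h j (by omega)
  have hreset : ‖wbar s - w k s‖ ≤ τ * C := by
    by_cases hsI : s ∈ I k
    · have hdiff : wbar s - w k s = ∑ h, p h • (∑ j ∈ Finset.range (Λ k h s), η j • g h j -
          ∑ j ∈ Finset.range s, η j • g h j) := by
        simp only [hwbar, hsync k s hsI, smul_sub, Finset.sum_sub_distrib]
        abel
      rw [hdiff]
      refine norm_sum_smul_le_of_sum_eq_one hp hpsum fun h => ?_
      obtain ⟨h₁, h₂⟩ := hstale k h s hsI
      exact norm_sum_range_sub_sum_range_le (c := s - τ) hC h₁ h₂ (by omega) (by omega)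
        fun j hj => hstep h j hj
    · obtain rfl : s = 0 := hs.resolve_right hsI
      simpa [hwbar, hw0] using mul_nonneg τ.cast_nonneg hC
  have hsplit : wbar t - w k t = (wbar s - w k s)
      - ∑ h, p h • (∑ j ∈ Finset.range t, η j • g h j - ∑ j ∈ Finset.range s, η j • g h j)
      + (∑ j ∈ Finset.range t, η j • g k j - ∑ j ∈ Finset.range s, η j • g k j) := by
    rw [hws]
    simp only [hwbar, smul_sub, Finset.sum_sub_distrib]
    abel
  have hbound : ‖wbar t - w k t‖ ≤ (τ + 2 * e k) * C := by
    rw [hsplit]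
    calc _ ≤ τ * C + e k * C + e k * C :=
          norm_add_le_of_le (norm_sub_le_of_le hreset
            (norm_sum_smul_le_of_sum_eq_one hp hpsum hdrift)) (hdrift k)
      _ = (τ + 2 * e k) * C := by ring
  calc ‖wbar t - w k t‖ ^ 2 ≤ ((τ + 2 * e k) * C) ^ 2 := by gcongr
    _ = 4 * (η t * G) ^ 2 * ((τ : ℝ) + 2 * e k) ^ 2 := by ring
    _ ≤ 4 * (η t * G) ^ 2 * (6 * (2 * (τ : ℝ) ^ 2 + (e k : ℝ) ^ 2)) := by
        gcongr
        nlinarith [sq_nonneg ((τ : ℝ) - e k), sq_nonneg (τ : ℝ)]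
    _ = 24 * η t ^ 2 * G ^ 2 * (2 * (τ : ℝ) ^ 2 + (e k : ℝ) ^ 2) := by ring
end

section
/- Work in ℝ^d (or any real inner product space). Consider K servers with weights p_k ≥ 0, Σ_{k=1}^K p_k = 1, local epoch lengths e_k ∈ ℕ₊, H = max_k e_k, and a staleness bound τ ∈ ℕ. Let g_{k,j} be vectors with ‖g_{k,j}‖ ≤ G, and let (η_j) be positive non-increasing learning rates with η_j ≤ 2·η_{j+H+τ} for all j. Define the virtual sequence w̄_t = w_0 − Σ_{k=1}^K p_k Σ_{j=0}^{t−1} η_j g_{k,j}. Each server k produces iterates with w_{k,0} = w_0 and a set I^k ⊆ ℕ of update times such that consecutive elements of I^k ∪ {0} differ by at most e_k; between update times w_{k,t+1} = w_{k,t} − η_t g_{k,t}, and at each update time s ∈ I^k the server receives w_{k,s} = w_0 − Σ_{h=1}^K p_h Σ_{j=0}^{Λ^h_{k,s}−1} η_j g_{h,j}, where |Λ^h_{k,s} − s| ≤ τ for every h. Then for every iteration t: Σ_{k=1}^K p_k ‖w̄_t − w_{k,t}‖² ≤ 24·η_t²·G²·(2τ² + Σ_{k=1}^K p_k e_k²).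 -/
theorem norm_sum_range_sub_sum_range_le_s5 {E : Type*} [SeminormedAddCommGroup E] {f : ℕ → E}
    {C : ℝ} {m a b : ℕ} (ha : m ≤ a) (hb : m ≤ b) (hf : ∀ j, m ≤ j → ‖f j‖ ≤ C) :
    ‖∑ j ∈ Finset.range a, f j - ∑ j ∈ Finset.range b, f j‖ ≤ |(a : ℝ) - b| * C := by
  wlog hab : b ≤ a generalizing a b
  · rw [norm_sub_rev, abs_sub_comm]
    exact this hb ha (le_of_not_ge hab)
  rw [← Finset.sum_Ico_eq_sub _ hab, abs_of_nonneg (sub_nonneg.2 (Nat.cast_le.2 hab)),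
    ← Nat.cast_sub hab, ← Nat.card_Ico, ← nsmul_eq_mul]
  exact (norm_sum_le _ _).trans (Finset.sum_le_card_nsmul _ _ _ fun j hj =>
    hf j (hb.trans (Finset.mem_Ico.1 hj).1))

/-- The last element of `insert 0 S` up to time `t`. -/
theorem exists_last_mem_insert_zero_le (S : Set ℕ) (t : ℕ) :
    ∃ s ∈ insert 0 S, s ≤ t ∧ ∀ j, s < j → j ≤ t → j ∉ S := by
  induction t with
  | zero => exact ⟨0, by simp, le_rfl, by omega⟩
  | succ t ih =>
    by_cases h : t + 1 ∈ S
    · exact ⟨t + 1, by simp [h], le_rfl, by omega⟩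
    · obtain ⟨s, hs, hst, hlast⟩ := ih
      refine ⟨s, hs, by omega, fun j hj hjt => ?_⟩
      rcases hjt.eq_or_lt with rfl | hlt
      · exact h
      · exact hlast j hj (by omega)

theorem eq_sub_sum_range_of_step {E : Type*} [AddCommGroup E] {w f : ℕ → E} {s t : ℕ}
    (hst : s ≤ t) (hstep : ∀ j, s ≤ j → j < t → w (j + 1) = w j - f j) :
    w t = w s - (∑ j ∈ Finset.range t, f j - ∑ j ∈ Finset.range s, f j) := by
  induction t, hst using Nat.le_induction with
  | base => simp
  | succ t hst ih =>
    rw [hstep t hst (by omega), ih fun j hj hjt => hstep j hj (by omega),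
      Finset.sum_range_succ]
    abel


/-- Lemma 2, second claim (inequality (29)), stated pathwise: in federated learning with
asynchronous coordination — `K` servers with weights `p`, local epoch lengths `e`,
`H = max_k e_k`, staleness bound `τ`, gradients `g k j` bounded in norm by `G`, positive
non-increasing learning rates with `η_j ≤ 2·η_{j+H+τ}`, virtual sequence
`w̄_t = w₀ − Σ_k p_k Σ_{j<t} η_j g_{k,j}`, local SGD steps between coordination times,
stale global models (with aggregation counters `Λ` within `τ` of the synchronization
index) received at coordination times `I k` whose consecutive gaps are at most `e k` —
every iteration `t` satisfies
`Σ_k p_k ‖w̄_t − w_{k,t}‖² ≤ 24·η_t²·G²·(2τ² + Σ_k p_k e_k²)`. -/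
theorem stmt_5 (d K : ℕ)
    (p : Fin K → ℝ) (hp : ∀ k, 0 ≤ p k) (hpsum : ∑ k, p k = 1)
    (e : Fin K → ℕ) (he : ∀ k, 0 < e k)
    (H : ℕ) (hH : H = Finset.univ.sup e)
    (τ : ℕ)
    (G : ℝ) (hG : 0 ≤ G)
    (g : Fin K → ℕ → EuclideanSpace ℝ (Fin d)) (hg : ∀ k j, ‖g k j‖ ≤ G)
    (η : ℕ → ℝ) (hηpos : ∀ j, 0 < η j) (hηmono : Antitone η)
    (hηdecay : ∀ j, η j ≤ 2 * η (j + H + τ))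
    (w0 : EuclideanSpace ℝ (Fin d))
    (wbar : ℕ → EuclideanSpace ℝ (Fin d))
    (hwbar : ∀ t, wbar t = w0 - ∑ k, p k • ∑ j ∈ Finset.range t, η j • g k j)
    (w : Fin K → ℕ → EuclideanSpace ℝ (Fin d))
    (hw0 : ∀ k, w k 0 = w0)
    (I : Fin K → Set ℕ)
    (hgap : ∀ k, ∀ s ∈ insert 0 (I k), ∃ s' ∈ I k, s < s' ∧ s' ≤ s + e k)
    (Λ : Fin K → Fin K → ℕ → ℕ)
    (hstale : ∀ k h : Fin K, ∀ s ∈ I k, Λ k h s ≤ s + τ ∧ s ≤ Λ k h s + τ)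
    (hlocal : ∀ k : Fin K, ∀ t : ℕ, (t + 1) ∉ I k →
      w k (t + 1) = w k t - η t • g k t)
    (hsync : ∀ k : Fin K, ∀ s ∈ I k,
      w k s = w0 - ∑ h, p h • ∑ j ∈ Finset.range (Λ k h s), η j • g h j) :
    ∀ t : ℕ,
      ∑ k, p k * ‖wbar t - w k t‖ ^ 2 ≤
        24 * η t ^ 2 * G ^ 2 * (2 * (τ : ℝ) ^ 2 + ∑ k, p k * (e k : ℝ) ^ 2) := by
  intro t
  have hη : ∀ j, t - (H + τ) ≤ j → η j ≤ 2 * η t := fun j hj => by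
    have := hηmono (show t ≤ j + H + τ by omega)
    linarith [hηdecay j]
  have hterm : ∀ k j, t - (H + τ) ≤ j → ‖η j • g k j‖ ≤ 2 * η t * G := fun k j hj => by
    rw [norm_smul, Real.norm_of_nonneg (hηpos j).le]
    exact mul_le_mul (hη j hj) (hg k j) (norm_nonneg _) (by linarith [hηpos t])
  have hC : 0 ≤ 2 * η t * G := by have := hηpos t; positivity
  have hdist : ∀ k, ‖wbar t - w k t‖ ≤ (τ + 2 * e k) * (2 * η t * G) := fun k => by
    obtain ⟨s, hs, hst, hlast⟩ := exists_last_mem_insert_zero_le (I k) t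
    have hte : t < s + e k := by
      obtain ⟨s', hs', hlt, hle⟩ := hgap k s hs
      by_contra hcon
      exact hlast s' hlt (by omega) hs'
    have heH : e k ≤ H := hH ▸ Finset.le_sup (Finset.mem_univ k)
    obtain ⟨L, hL, hwL⟩ : ∃ L : Fin K → ℕ, (∀ h, L h ≤ s + τ ∧ s ≤ L h + τ) ∧
        w k s = w0 - ∑ h, p h • ∑ j ∈ Finset.range (L h), η j • g h j := by
      by_cases hsI : s ∈ I k
      · exact ⟨fun h => Λ k h s, fun h => hstale k h s hsI, hsync k s hsI⟩
      · obtain rfl : s = 0 := (Set.mem_insert_iff.1 hs).resolve_right hsI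
        exact ⟨0, by simp, by simp [hw0]⟩
    have hwt := eq_sub_sum_range_of_step (w := w k) (f := fun j => η j • g k j) hst
      fun j hj hjt => hlocal k j (hlast (j + 1) (by omega) (by omega))
    have hsplit : wbar t - w k t =
        ∑ h, p h • (∑ j ∈ Finset.range (L h), η j • g h j - ∑ j ∈ Finset.range t, η j • g h j) +
        (∑ j ∈ Finset.range t, η j • g k j - ∑ j ∈ Finset.range s, η j • g k j) := by
      rw [hwt, hwL, hwbar]
      simp only [smul_sub, Finset.sum_sub_distrib]
      abel
    have hst' : (s : ℝ) ≤ t := Nat.cast_le.2 hst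
    have hte' : (t : ℝ) ≤ s + e k := by exact_mod_cast hte.le
    have hstaleness : ‖∑ h, p h • (∑ j ∈ Finset.range (L h), η j • g h j -
        ∑ j ∈ Finset.range t, η j • g h j)‖ ≤ (τ + e k) * (2 * η t * G) := by
      calc _ ≤ ∑ h, p h * ((τ + e k) * (2 * η t * G)) := by
            refine norm_sum_le_of_le _ fun h _ => ?_
            obtain ⟨hL₁, hL₂⟩ := hL h
            rw [norm_smul, Real.norm_of_nonneg (hp h)]
            refine mul_le_mul_of_nonneg_left ?_ (hp h)
            refine (norm_sum_range_sub_sum_range_le_s5 (m := t - (H + τ)) (by omega) (by omega)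
              (hterm h)).trans (mul_le_mul_of_nonneg_right ?_ hC)
            have h₁ : (L h : ℝ) ≤ s + τ := by exact_mod_cast hL₁
            have h₂ : (s : ℝ) ≤ L h + τ := by exact_mod_cast hL₂
            rw [abs_le]
            constructor <;> linarith
        _ = _ := by rw [← Finset.sum_mul, hpsum, one_mul]
    have hdrift : ‖∑ j ∈ Finset.range t, η j • g k j - ∑ j ∈ Finset.range s, η j • g k j‖ ≤
        e k * (2 * η t * G) := by
      refine (norm_sum_range_sub_sum_range_le_s5 (m := t - (H + τ)) (by omega) (by omega)
        (hterm k)).trans (mul_le_mul_of_nonneg_right ?_ hC)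
      rw [abs_le]
      constructor <;> linarith
    rw [hsplit]
    refine (norm_add_le _ _).trans ((add_le_add hstaleness hdrift).trans_eq ?_)
    ring
  calc ∑ k, p k * ‖wbar t - w k t‖ ^ 2
      ≤ ∑ k, p k * (24 * η t ^ 2 * G ^ 2 * (2 * (τ : ℝ) ^ 2 + (e k : ℝ) ^ 2)) := by
        refine Finset.sum_le_sum fun k _ => mul_le_mul_of_nonneg_left ?_ (hp k)
        calc ‖wbar t - w k t‖ ^ 2 ≤ ((τ + 2 * e k) * (2 * η t * G)) ^ 2 :=
              pow_le_pow_left₀ (norm_nonneg _) (hdist k) 2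
          _ = (4 * η t ^ 2 * G ^ 2) * ((τ : ℝ) + 2 * e k) ^ 2 := by ring
          _ ≤ (4 * η t ^ 2 * G ^ 2) * (6 * (2 * (τ : ℝ) ^ 2 + (e k : ℝ) ^ 2)) := by
              refine mul_le_mul_of_nonneg_left ?_ (by positivity)
              nlinarith [sq_nonneg ((τ : ℝ) - e k), sq_nonneg (τ : ℝ)]
          _ = _ := by ring
    _ = 24 * η t ^ 2 * G ^ 2 * ∑ k, p k * (2 * (τ : ℝ) ^ 2 + (e k : ℝ) ^ 2) := by
        rw [Finset.mul_sum]
        exact Finset.sum_congr rfl fun k _ => by ring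
    _ = _ := by
        simp only [mul_add, Finset.sum_add_distrib, ← Finset.sum_mul, hpsum, one_mul]
end

section
/- Let A, B, C, D, ζ₁, ζ₂, a₁, a₂, b₁, b₂, u₁, u₂ be nonnegative reals, ε a real with ε > D, and α ∈ [0,1]. Define f : (0,∞) × (0,∞) → ℝ by f(e, n) = ((A/n + B·e² + C)/(ε − D))·((1−α)·(ζ₁ + a₁·e·n + b₁·e + u₁)/e + α·(ζ₂ + a₂·e·n + b₂·e + u₂)/e). Then f is biconvex: for every fixed n > 0 the map e ↦ f(e, n) is convex on (0,∞), and for every fixed e > 0 the map n ↦ f(e, n) is convex on (0,∞). -/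
/-- `x ↦ p / x + q + r x + s x²` is convex on `(0, ∞)` when `p` and `s` are nonnegative. -/
theorem convexOn_inv_add_quadratic {p s : ℝ} (hp : 0 ≤ p) (hs : 0 ≤ s) (q r : ℝ) :
    ConvexOn ℝ (Set.Ioi (0 : ℝ)) (fun x : ℝ => p * x⁻¹ + (q + r * x + s * x ^ 2)) := by
  have hinv : ConvexOn ℝ (Set.Ioi (0 : ℝ)) (fun x : ℝ => x⁻¹) := by
    simpa using convexOn_zpow (𝕜 := ℝ) (-1)
  refine (hinv.smul hp).add ⟨convex_Ioi 0, fun x _ y _ a b ha hb hab => ?_⟩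
  obtain rfl : b = 1 - a := by linarith
  simp only [smul_eq_mul]
  nlinarith [mul_nonneg hs (mul_nonneg (mul_nonneg ha hb) (sq_nonneg (x - y)))]

/-- Lemma 3 of the paper: the approximate expected model-training time of TS-FL-ASC
with load forwarding,
`f(e, n) = ((A/n + B·e² + C)/(ε − D)) · ((1−α)·(ζ₁ + a₁·e·n + b₁·e + u₁)/e
            + α·(ζ₂ + a₂·e·n + b₂·e + u₂)/e)`,
is biconvex on `(0,∞) × (0,∞)`: convex in `e` for each fixed `n > 0`, and convex in `n`
for each fixed `e > 0`. -/
theorem stmt_7 (A B C D ζ₁ ζ₂ a₁ a₂ b₁ b₂ u₁ u₂ ε α : ℝ)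
    (hA : 0 ≤ A) (hB : 0 ≤ B) (hC : 0 ≤ C) (hD : 0 ≤ D)
    (hζ₁ : 0 ≤ ζ₁) (hζ₂ : 0 ≤ ζ₂) (ha₁ : 0 ≤ a₁) (ha₂ : 0 ≤ a₂)
    (hb₁ : 0 ≤ b₁) (hb₂ : 0 ≤ b₂) (hu₁ : 0 ≤ u₁) (hu₂ : 0 ≤ u₂)
    (hε : D < ε) (hα₀ : 0 ≤ α) (hα₁ : α ≤ 1) :
    (∀ n : ℝ, 0 < n →
      ConvexOn ℝ (Set.Ioi (0 : ℝ))
        (fun e : ℝ => (A / n + B * e ^ 2 + C) / (ε - D) *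
          ((1 - α) * (ζ₁ + a₁ * e * n + b₁ * e + u₁) / e +
            α * (ζ₂ + a₂ * e * n + b₂ * e + u₂) / e))) ∧
    (∀ e : ℝ, 0 < e →
      ConvexOn ℝ (Set.Ioi (0 : ℝ))
        (fun n : ℝ => (A / n + B * e ^ 2 + C) / (ε - D) *
          ((1 - α) * (ζ₁ + a₁ * e * n + b₁ * e + u₁) / e +
            α * (ζ₂ + a₂ * e * n + b₂ * e + u₂) / e))) := by
  have hε' : 0 < ε - D := sub_pos.mpr hε
  have hα : 0 ≤ 1 - α := sub_nonneg.mpr hα₁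
  constructor
  · intro n hn
    refine (convexOn_inv_add_quadratic
      (p := (A / n + C) * ((1 - α) * (ζ₁ + u₁) + α * (ζ₂ + u₂)) / (ε - D))
      (s := B * ((1 - α) * (a₁ * n + b₁) + α * (a₂ * n + b₂)) / (ε - D))
      (by positivity) (by positivity)
      ((A / n + C) * ((1 - α) * (a₁ * n + b₁) + α * (a₂ * n + b₂)) / (ε - D))
      (B * ((1 - α) * (ζ₁ + u₁) + α * (ζ₂ + u₂)) / (ε - D))).congr fun e he => ?_
    have he₀ : e ≠ 0 := ne_of_gt he
    field_simp
    ring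
  · intro e he
    refine (convexOn_inv_add_quadratic
      (p := A * ((1 - α) * (ζ₁ + b₁ * e + u₁) + α * (ζ₂ + b₂ * e + u₂)) / (e * (ε - D)))
      (by positivity) le_rfl
      ((A * ((1 - α) * a₁ + α * a₂) + (B * e ^ 2 + C) *
        ((1 - α) * (ζ₁ + b₁ * e + u₁) + α * (ζ₂ + b₂ * e + u₂)) / e) / (ε - D))
      ((B * e ^ 2 + C) * ((1 - α) * a₁ + α * a₂) / (ε - D))).congr fun n hn => ?_
    have hn₀ : n ≠ 0 := ne_of_gt hn
    field_simp
    ring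
end
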